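/- arXiv:math/0306397 — 5 statements merged into one kernel-verified Lean document; each statement's English description precedes it below -/
import Mathlib

section
/- Let n be a natural number and let α, β be rational numbers. Then the evaluated cycle index of the full symmetric group S_n at the alternating substitution x(k) = α for k odd and x(k) = β for k even satisfies Z(S_n; α, β, α, β, …) = Σ_{i=0}^{n} Ring.choose((α−β)/2, i) · (−1)^{n−i} · Ring.choose(−(α+β)/2, n−i); equivalently, Z(S_n; α, β, α, β, …) is the coefficient of t^n in the formal power series (1−t)^{−(α+β)/2}·(1+t)^{(α−β)/2}. -/
/- `cycCount π k` is the number of cycles of length `k` in the cycle decomposition of the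
permutation `π` of a finite type, where fixed points are counted as cycles of length `1`. -/
def cycCount {α : Type*} [Fintype α] [DecidableEq α] (π : Equiv.Perm α) (k : ℕ) : ℕ :=
  if k = 1 then Fintype.card α - π.support.card else π.cycleType.count k

/- The evaluated cycle index `Z(G; x)` of a subgroup `G` of the permutations of a finite
type `α`: `(1/|G|) · Σ_{π ∈ G} Π_{k=1}^{card α} x(k)^{c_k(π)}`. -/
open scoped Classical in
noncomputable def cycleIndex {α : Type*} [Fintype α] [DecidableEq α]
    (G : Subgroup (Equiv.Perm α)) (x : ℕ → ℚ) : ℚ :=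
  (1 / (Nat.card G : ℚ)) *
    ∑ π ∈ Finset.univ.filter (fun π => π ∈ G),
      ∏ k ∈ Finset.Icc 1 (Fintype.card α), x k ^ cycCount π k

theorem succ_mul_choose_succ (r : ℚ) (n : ℕ) :
    ((n : ℚ) + 1) * Ring.choose r (n + 1) = (r - n) * Ring.choose r n := by
  have h := Ring.choose_smul_choose r (Nat.le_succ n)
  simp only [Nat.succ_eq_add_one, Nat.choose_succ_self_right, nsmul_eq_mul, Nat.cast_add,
    Nat.cast_one, add_tsub_cancel_left, Ring.choose_one_right] at h
  rw [h, mul_comm]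

/-- The summand of the cycle index of a symmetric group belonging to a cycle type `m`. -/
def cycleTypeWeight (x : ℕ → ℚ) (m : Multiset ℕ) : ℚ :=
  ∏ k ∈ m.toFinset, (x k / k) ^ m.count k / (m.count k).factorial

theorem cycleTypeWeight_eq_prod (x : ℕ → ℚ) {m : Multiset ℕ} {s : Finset ℕ}
    (h : m.toFinset ⊆ s) :
    cycleTypeWeight x m = ∏ k ∈ s, (x k / k) ^ m.count k / (m.count k).factorial := by
  refine Finset.prod_subset h fun k _ hk => ?_
  rw [Multiset.mem_toFinset] at hk
  simp [Multiset.count_eq_zero_of_notMem hk]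

theorem count_mul_cycleTypeWeight (x : ℕ → ℚ) {m : Multiset ℕ} {a : ℕ} (ha : 0 < a)
    (h : a ∈ m) :
    ((m.count a : ℚ) * a) * cycleTypeWeight x m = x a * cycleTypeWeight x (m.erase a) := by
  have hs : a ∈ m.toFinset := Multiset.mem_toFinset.2 h
  rw [cycleTypeWeight_eq_prod x (m := m.erase a) (s := m.toFinset)
    (Multiset.toFinset_subset.2 (Multiset.erase_subset a m)), cycleTypeWeight,
    ← Finset.mul_prod_erase _ _ hs, ← Finset.mul_prod_erase _ _ hs, ← mul_assoc, ← mul_assoc]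
  congr 1
  · rw [Multiset.count_erase_self]
    obtain ⟨c, hc⟩ := Nat.exists_eq_succ_of_ne_zero (Multiset.count_ne_zero.2 h)
    have ha' : (a : ℚ) ≠ 0 := by positivity
    have hc' : (c.factorial : ℚ) ≠ 0 := by positivity
    rw [hc, Nat.succ_sub_one, Nat.factorial_succ, pow_succ]
    push_cast
    field_simp
  · refine Finset.prod_congr rfl fun k hk => ?_
    rw [Multiset.count_erase_of_ne (Finset.ne_of_mem_erase hk)]

/-- The sum of the cycle type weights over all partitions of `n`. -/
def partitionWeightSum (x : ℕ → ℚ) (n : ℕ) : ℚ :=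
  ∑ p : n.Partition, cycleTypeWeight x p.parts

theorem mul_partitionWeightSum (x : ℕ → ℚ) (n : ℕ) :
    n * partitionWeightSum x n = ∑ k ∈ Finset.Icc 1 n, x k * partitionWeightSum x (n - k) := by
  have h1 (p : n.Partition) : (n : ℚ) = ∑ k ∈ Finset.Icc 1 n, (p.parts.count k : ℚ) * k := by
    have h := p.parts_sum
    rw [Finset.sum_multiset_count_of_subset p.parts (Finset.Icc 1 n) fun k hk => by
      rw [Multiset.mem_toFinset] at hk
      exact Finset.mem_Icc.2 ⟨p.parts_pos hk, p.le_of_mem_parts hk⟩] at h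
    conv_lhs => rw [← h]
    push_cast [smul_eq_mul]
    rfl
  calc n * partitionWeightSum x n
      = ∑ p : n.Partition, ∑ k ∈ Finset.Icc 1 n,
          ((p.parts.count k : ℚ) * k) * cycleTypeWeight x p.parts := by
        rw [partitionWeightSum, Finset.mul_sum]
        refine Finset.sum_congr rfl fun p _ => ?_
        rw [← Finset.sum_mul, ← h1 p]
    _ = _ := by
        rw [Finset.sum_comm]
        refine Finset.sum_congr rfl fun k hk => ?_
        obtain ⟨hk1, hkn⟩ := Finset.mem_Icc.1 hk
        rw [partitionWeightSum, Finset.mul_sum,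
          ← (Nat.Partition.partitionWithPartEquiv hk1 hkn).sum_comp,
          ← Finset.sum_filter_of_ne (p := fun p : n.Partition => k ∈ p.parts)]
        · rw [← Finset.sum_subtype_eq_sum_filter, Finset.subtype_univ]
          refine Finset.sum_congr rfl fun p _ => ?_
          rw [Nat.Partition.partitionWithPartEquiv_apply_parts,
            count_mul_cycleTypeWeight x hk1 p.2]
        · intro p _ hp
          by_contra hkp
          simp [Multiset.count_eq_zero_of_notMem hkp] at hp

section Perm

variable {α : Type*} [Fintype α] [DecidableEq α]

theorem cycCount_eq_count_partition (π : Equiv.Perm α) (k : ℕ) :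
    cycCount π k = π.partition.parts.count k := by
  rw [cycCount, Equiv.Perm.parts_partition, Multiset.count_add, Multiset.count_replicate]
  split_ifs with h h' h'
  · subst h
    rw [Multiset.count_eq_zero_of_notMem, zero_add]
    exact fun h => absurd (Equiv.Perm.one_lt_of_mem_cycleType h) (lt_irrefl 1)
  · exact absurd h.symm h'
  · exact absurd h'.symm h
  · rfl

theorem Nat.Partition.parts_eq_filter_add {n : ℕ} (p : n.Partition) :
    p.parts = p.parts.filter (2 ≤ ·) + Multiset.replicate (p.parts.count 1) 1 := by
  conv_lhs => rw [← Multiset.filter_add_not (2 ≤ ·) p.parts]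
  rw [← Multiset.filter_eq']
  congr 1
  refine Multiset.filter_congr fun k hk => ?_
  have := p.parts_pos hk
  omega

theorem Nat.Partition.count_one_eq_sub {n : ℕ} (p : n.Partition) :
    p.parts.count 1 = n - (p.parts.filter (2 ≤ ·)).sum := by
  have h := congrArg Multiset.sum p.parts_eq_filter_add
  rw [p.parts_sum, Multiset.sum_add, Multiset.sum_replicate, smul_eq_mul, mul_one] at h
  omega

theorem Equiv.Perm.partition_eq_iff_cycleType_eq (π : Equiv.Perm α)
    (p : (Fintype.card α).Partition) :
    π.partition = p ↔ π.cycleType = p.parts.filter (2 ≤ ·) := by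
  constructor
  · rintro rfl
    exact Equiv.Perm.filter_parts_partition_eq_cycleType.symm
  · intro h
    refine Nat.Partition.ext ?_
    rw [p.parts_eq_filter_add, p.count_one_eq_sub, ← h, Equiv.Perm.parts_partition,
      Equiv.Perm.sum_cycleType]

theorem card_partition_fiber_mul (p : (Fintype.card α).Partition) :
    (Finset.univ.filter fun π : Equiv.Perm α => π.partition = p).card *
      ∏ k ∈ Finset.Icc 1 (Fintype.card α), (k ^ p.parts.count k * (p.parts.count k).factorial) =
      (Fintype.card α).factorial := by
  have hm := Equiv.Perm.card_of_cycleType_mul_eq α (p.parts.filter (2 ≤ ·))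
  rw [if_pos ⟨by
    have h := congrArg Multiset.sum p.parts_eq_filter_add
    rw [p.parts_sum, Multiset.sum_add] at h
    omega, fun a ha => (Multiset.mem_filter.1 ha).2⟩, ← p.count_one_eq_sub] at hm
  simp_rw [Equiv.Perm.partition_eq_iff_cycleType_eq]
  rw [← hm]
  congr 1
  have hsub {s : Finset ℕ} (hs : p.parts.toFinset ⊆ s) :
      ∏ k ∈ p.parts.toFinset, (k ^ p.parts.count k * (p.parts.count k).factorial) =
        ∏ k ∈ s, (k ^ p.parts.count k * (p.parts.count k).factorial) := by
    refine Finset.prod_subset hs fun k _ hk => ?_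
    rw [Multiset.mem_toFinset] at hk
    simp [Multiset.count_eq_zero_of_notMem hk]
  rw [← hsub fun k hk => ?_, hsub (s := insert 1 (p.parts.filter (2 ≤ ·)).toFinset) fun k hk => ?_,
    Finset.prod_insert (by simp), one_pow, one_mul, mul_assoc, Finset.prod_multiset_count,
    ← Finset.prod_mul_distrib]
  · congr 1
    refine Finset.prod_congr rfl fun k hk => ?_
    rw [Multiset.mem_toFinset, Multiset.mem_filter] at hk
    rw [Multiset.count_filter_of_pos hk.2]
  · rw [Multiset.mem_toFinset] at hk
    have := p.parts_pos hk
    rw [Finset.mem_insert, Multiset.mem_toFinset, Multiset.mem_filter]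
    exact (em (k = 1)).imp_right fun h => ⟨hk, by omega⟩
  · rw [Multiset.mem_toFinset] at hk
    exact Finset.mem_Icc.2 ⟨p.parts_pos hk, p.le_of_mem_parts hk⟩

theorem cycleIndex_top_eq_partitionWeightSum (x : ℕ → ℚ) :
    cycleIndex (⊤ : Subgroup (Equiv.Perm α)) x = partitionWeightSum x (Fintype.card α) := by
  have hN : ((Fintype.card α).factorial : ℚ) ≠ 0 := by positivity
  rw [cycleIndex, partitionWeightSum, Subgroup.card_top, Nat.card_eq_fintype_card,
    Fintype.card_perm, one_div, inv_mul_eq_iff_eq_mul₀ hN, Finset.mul_sum]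
  simp only [Subgroup.mem_top, Finset.filter_true, cycCount_eq_count_partition]
  rw [← Finset.sum_fiberwise (g := fun π : Equiv.Perm α => π.partition)]
  refine Finset.sum_congr rfl fun p _ => ?_
  rw [Finset.sum_congr rfl (g := fun _ =>
      ∏ k ∈ Finset.Icc 1 (Fintype.card α), x k ^ p.parts.count k)
      fun π hπ => by rw [(Finset.mem_filter.1 hπ).2],
    Finset.sum_const, nsmul_eq_mul, ← card_partition_fiber_mul p, Nat.cast_mul, Nat.cast_prod,
    mul_assoc, cycleTypeWeight_eq_prod x (s := Finset.Icc 1 (Fintype.card α)) fun k hk => by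
      rw [Multiset.mem_toFinset] at hk
      exact Finset.mem_Icc.2 ⟨p.parts_pos hk, p.le_of_mem_parts hk⟩,
    ← Finset.prod_mul_distrib]
  congr 1
  refine Finset.prod_congr rfl fun k hk => ?_
  have hk0 : (k : ℚ) ≠ 0 := Nat.cast_ne_zero.2 (Nat.one_le_iff_ne_zero.1 (Finset.mem_Icc.1 hk).1)
  have hc : ((p.parts.count k).factorial : ℚ) ≠ 0 := by positivity
  push_cast
  rw [div_pow]
  field_simp

end Perm

@[simp]
theorem partitionWeightSum_zero (x : ℕ → ℚ) : partitionWeightSum x 0 = 1 := by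
  simp [partitionWeightSum, cycleTypeWeight]

@[simp]
theorem partitionWeightSum_one (x : ℕ → ℚ) : partitionWeightSum x 1 = x 1 := by
  simpa using mul_partitionWeightSum x 1

theorem partitionWeightSum_add_two {x : ℕ → ℚ} (hx : ∀ k, 1 ≤ k → x (k + 2) = x k) (n : ℕ) :
    ((n : ℚ) + 2) * partitionWeightSum x (n + 2) =
      x 1 * partitionWeightSum x (n + 1) + (x 2 + n) * partitionWeightSum x n := by
  have h := mul_partitionWeightSum x (n + 2)
  have h' := mul_partitionWeightSum x n
  rw [← Finset.Ico_add_one_right_eq_Icc, Finset.sum_Ico_eq_sum_range, Nat.add_sub_cancel] at h h'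
  rw [Finset.sum_range_succ', Finset.sum_range_succ'] at h
  have hs : ∀ k, x (1 + (k + 1 + 1)) * partitionWeightSum x (n + 2 - (1 + (k + 1 + 1))) =
      x (1 + k) * partitionWeightSum x (n - (1 + k)) := fun k => by
    rw [show 1 + (k + 1 + 1) = 1 + k + 2 by ring, hx _ (by omega), Nat.add_sub_add_right]
  simp only [hs, ← h'] at h
  norm_num at h
  linear_combination h

open PowerSeries in
theorem derivative_mul_eq_of_one_sub_X_of_one_add_X {a b : ℚ} {A B : ℚ⟦X⟧}
    (hA : (1 - X) * d⁄dX ℚ A = C a * A) (hB : (1 + X) * d⁄dX ℚ B = C b * B) :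
    d⁄dX ℚ (A * B) = C (a + b) * (A * B) + X * (C (a - b) * (A * B)) + X * (X * d⁄dX ℚ (A * B)) := by
  have h : d⁄dX ℚ (A * B) = A * d⁄dX ℚ B + B * d⁄dX ℚ A := by
    simp [Derivation.leibniz]
  rw [h, map_add, map_sub]
  linear_combination ((1 + X) * B) * hA + ((1 - X) * A) * hB

open PowerSeries in
theorem one_add_X_mul_derivative_mk_choose (b : ℚ) :
    (1 + X) * d⁄dX ℚ (mk fun n => Ring.choose b n) = C b * mk fun n => Ring.choose b n := by
  ext n
  have h := succ_mul_choose_succ b n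
  rw [add_mul, one_mul, map_add, coeff_C_mul, coeff_derivative, coeff_mk, coeff_mk]
  cases n with
  | zero =>
    rw [coeff_zero_X_mul]
    push_cast at h ⊢
    linear_combination h
  | succ n =>
    rw [coeff_succ_X_mul, coeff_derivative, coeff_mk]
    push_cast at h ⊢
    linear_combination h

open PowerSeries in
theorem one_sub_X_mul_derivative_mk_choose_neg (a : ℚ) :
    (1 - X) * d⁄dX ℚ (mk fun n => (-1) ^ n * Ring.choose (-a) n) =
      C a * mk fun n => (-1) ^ n * Ring.choose (-a) n := by
  ext n
  have h := succ_mul_choose_succ (-a) n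
  rw [sub_mul, one_mul, map_sub, coeff_C_mul, coeff_derivative, coeff_mk, coeff_mk]
  cases n with
  | zero =>
    rw [coeff_zero_X_mul]
    push_cast at h ⊢
    linear_combination -h
  | succ n =>
    rw [coeff_succ_X_mul, coeff_derivative, coeff_mk]
    push_cast at h ⊢
    linear_combination (-1) ^ n * h

open PowerSeries in
theorem partitionWeightSum_eq_coeff {x : ℕ → ℚ} (hx : ∀ k, 1 ≤ k → x (k + 2) = x k)
    {F : ℚ⟦X⟧} (h0 : coeff 0 F = 1)
    (hF : d⁄dX ℚ F = C (x 1) * F + X * (C (x 2) * F) + X * (X * d⁄dX ℚ F)) (n : ℕ) :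
    partitionWeightSum x n = coeff n F := by
  induction n using Nat.twoStepInduction with
  | zero => rw [partitionWeightSum_zero, h0]
  | one =>
    have h := congrArg (coeff 0) hF
    simp only [map_add, coeff_zero_X_mul, coeff_C_mul, coeff_derivative, h0] at h
    rw [partitionWeightSum_one]
    push_cast at h
    linear_combination -h
  | more n ih ih' =>
    have h := congrArg (coeff (n + 1)) hF
    have hX : coeff n (X * d⁄dX ℚ F) = n * coeff n F := by
      cases n with
      | zero => simp
      | succ n => rw [coeff_succ_X_mul, coeff_derivative, mul_comm]; push_cast; rfl
    simp only [map_add, coeff_succ_X_mul, coeff_C_mul, hX] at h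
    rw [coeff_derivative] at h
    have hP := partitionWeightSum_add_two hx n
    rw [ih, ih'] at hP
    have hn : (n : ℚ) + 2 ≠ 0 := by positivity
    refine mul_left_cancel₀ hn ?_
    push_cast at h
    linear_combination hP - h

/-- the evaluated cycle index of the full symmetric group `S_n` at the
alternating substitution `x(k) = α` for `k` odd, `x(k) = β` for `k` even equals
`Σ_{i=0}^{n} Ring.choose((α−β)/2, i) · (−1)^{n−i} · Ring.choose(−(α+β)/2, n−i)`,
i.e. the coefficient of `t^n` in `(1−t)^{−(α+β)/2}·(1+t)^{(α−β)/2}`. -/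
theorem cycleIndex_symm_alternating (n : ℕ) (α β : ℚ) :
    cycleIndex (⊤ : Subgroup (Equiv.Perm (Fin n))) (fun k => if Odd k then α else β) =
      ∑ i ∈ Finset.range (n + 1),
        Ring.choose ((α - β) / 2) i * (-1 : ℚ) ^ (n - i) *
          Ring.choose (-(α + β) / 2) (n - i) := by
  have hx (k : ℕ) (_ : 1 ≤ k) :
      (if Odd (k + 2) then α else β) = if Odd k then α else β := by
    simp [Nat.odd_add, parity_simps]
  rw [cycleIndex_top_eq_partitionWeightSum, Fintype.card_fin]
  have hF := derivative_mul_eq_of_one_sub_X_of_one_add_X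
    (one_sub_X_mul_derivative_mk_choose_neg ((α + β) / 2))
    (one_add_X_mul_derivative_mk_choose ((α - β) / 2))
  rw [show (α + β) / 2 + (α - β) / 2 = α by ring,
    show (α + β) / 2 - (α - β) / 2 = β by ring, mul_comm (PowerSeries.mk _)] at hF
  rw [partitionWeightSum_eq_coeff hx ?_
    (by simpa only [odd_one, if_true, show ¬ Odd 2 by decide, if_false] using hF),
    PowerSeries.coeff_mul, Finset.Nat.sum_antidiagonal_eq_sum_range_succ_mk]
  · refine Finset.sum_congr rfl fun i _ => ?_
    rw [PowerSeries.coeff_mk, PowerSeries.coeff_mk, neg_div, mul_assoc]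
  · simp [PowerSeries.coeff_mul]
end

section
/- Let n be a natural number and let α be a rational number. Then (1/n!) · Σ_{π ∈ S_n} α^{c(π)} = (−1)^n · Ring.choose(−α, n), where c(π) = Σ_k c_k(π) is the total number of cycles of π (fixed points counted as 1-cycles). Equivalently, the evaluated cycle index Z(S_n; α, α, α, …) with every variable set equal to α equals (−1)^n · Ring.choose(−α, n). -/
open Equiv Equiv.Perm in
/-- Merging a fixed point into another cycle lowers the number of cycles by one. -/
theorem card_parts_partition_swap_mul {β : Type*} [Fintype β] [DecidableEq β] {x y : β}
    (hxy : x ≠ y) {σ : Perm β} (hx : σ x = x) :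
    (swap x y * σ).partition.parts.card + 1 = σ.partition.parts.card := by
  obtain ⟨l, hl, hlσ, τ, hτ, hστ⟩ : ∃ l : List β, (y :: l).Nodup ∧ x ∉ y :: l ∧
      ∃ τ : Perm β, (∀ z ∈ x :: y :: l, τ z = z) ∧ σ = (y :: l).formPerm * τ := by
    by_cases hy : σ y = y
    · exact ⟨[], by simp, by simpa using hxy, σ, by simp [hx, hy], by simp⟩
    have hys : y ∈ σ.support := mem_support.2 hy
    have hne : σ.toList y ≠ [] := by simpa [toList_eq_nil_iff] using hy
    obtain ⟨a, l, hal⟩ := List.exists_cons_of_ne_nil hne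
    have hay : a = y := by
      have := toList_getElem_zero σ y hys
      simpa [hal] using this
    subst hay
    have hnx : x ∉ σ.toList a := fun h =>
      hxy ((mem_toList_iff.1 h).1.symm.eq_of_left hx)
    refine ⟨l, hal ▸ nodup_toList σ a, hal ▸ hnx, (σ.cycleOf a)⁻¹ * σ, ?_, ?_⟩
    · rw [← hal]
      intro z hz
      rcases List.mem_cons.1 hz with rfl | hz
      · rw [mul_apply, hx, inv_eq_iff_eq, cycleOf_apply, if_neg]
        intro h
        exact hnx (mem_toList_iff.2 ⟨h, hys⟩)
      · rw [mul_apply, inv_eq_iff_eq, (mem_toList_iff.1 hz).1.cycleOf_apply]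
    · rw [← hal, formPerm_toList, mul_inv_cancel_left]
  have hl' : (x :: y :: l).Nodup := List.nodup_cons.2 ⟨hlσ, hl⟩
  have hd (m : List β) (hm : ∀ z ∈ m, τ z = z) : Disjoint m.formPerm τ := fun z => by
    by_cases hz : z ∈ m
    · exact Or.inr (hm z hz)
    · exact Or.inl (List.formPerm_apply_of_notMem hz)
  have hd₂ := hd _ hτ
  have hd₁ := hd (y :: l) fun z hz => hτ z (List.mem_cons_of_mem _ hz)
  have hsup₂ : (x :: y :: l).formPerm.support.card = l.length + 2 := by
    rw [List.support_formPerm_of_nodup _ hl' (by simp), List.toFinset_card_of_nodup hl']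
    simp
  have hct₂ := (List.isCycle_formPerm hl' (by simp)).cycleType
  have e₂ : swap x y * σ = (x :: y :: l).formPerm * τ := by
    rw [hστ, List.formPerm_cons_cons, mul_assoc]
  have hle₂ := Finset.card_le_univ (swap x y * σ).support
  have hle₁ := Finset.card_le_univ σ.support
  simp only [parts_partition, Multiset.card_add, Multiset.card_replicate]
  rw [e₂, hd₂.card_support_mul, hsup₂] at hle₂ ⊢
  rw [hστ, hd₁.card_support_mul] at hle₁ ⊢
  rw [hd₂.cycleType_mul, hd₁.cycleType_mul, hct₂]
  simp only [Multiset.card_add, Multiset.card_singleton]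
  rcases l with _ | ⟨z, l⟩
  · simp only [List.formPerm_singleton, cycleType_one, support_one, Finset.card_empty,
      Multiset.card_zero, List.length_nil] at *
    omega
  · have hsup₁ : (y :: z :: l).formPerm.support.card = l.length + 2 := by
      rw [List.support_formPerm_of_nodup _ hl (by simp), List.toFinset_card_of_nodup hl]
      simp
    rw [(List.isCycle_formPerm hl (by simp)).cycleType, hsup₁] at *
    simp only [Multiset.card_singleton, List.length_cons] at *
    omega

open Equiv Equiv.Perm in
theorem decomposeFin_symm_eq_swap_mul {n : ℕ} (p : Fin (n + 1)) (e : Perm (Fin n)) :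
    decomposeFin.symm (p, e) = swap 0 p * decomposeFin.symm (0, e) := by
  ext i
  refine Fin.cases ?_ (fun i => ?_) i <;> simp

open Equiv Equiv.Perm in
theorem card_parts_partition_decomposeFin_symm_zero {n : ℕ} (e : Perm (Fin n)) :
    (decomposeFin.symm (0, e)).partition.parts.card = e.partition.parts.card + 1 := by
  have h : decomposeFin.symm (0, e) = e.extendDomain (finSuccAboveEquiv 0) := by
    ext i
    refine Fin.cases ?_ (fun i => ?_) i
    · rw [extendDomain_apply_not_subtype _ _ (by simp)]
      simp
    · have := extendDomain_apply_image e (finSuccAboveEquiv (0 : Fin (n + 1))) i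
      simp only [finSuccAboveEquiv_apply, Fin.zero_succAbove] at this
      simp [this]
  have hle := Finset.card_le_univ e.support
  simp only [parts_partition, Multiset.card_add, Multiset.card_replicate]
  rw [h, cycleType_extendDomain, card_support_extend_domain]
  simp only [Fintype.card_fin] at *
  omega

open Equiv Equiv.Perm in
/-- The generating function of permutations by number of cycles is the rising factorial. -/
theorem sum_perm_pow_card_parts_partition {R : Type*} [CommSemiring R] (n : ℕ) (a : R) :
    ∑ σ : Perm (Fin n), a ^ σ.partition.parts.card = (ascPochhammer R n).eval a := by
  induction n with
  | zero => simp [parts_partition, Subsingleton.elim (default : Perm (Fin 0)) 1]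
  | succ n ih =>
    rw [ascPochhammer_succ_eval, ← ih, ← decomposeFin.symm.sum_comp, Fintype.sum_prod_type_right,
      Finset.sum_mul]
    refine Finset.sum_congr rfl fun e _ => ?_
    have h (i : Fin n) :
        (decomposeFin.symm (i.succ, e)).partition.parts.card = e.partition.parts.card := by
      have := card_parts_partition_swap_mul (Fin.succ_ne_zero i).symm
        (decomposeFin_symm_apply_zero 0 e)
      rw [← decomposeFin_symm_eq_swap_mul, card_parts_partition_decomposeFin_symm_zero] at this
      omega
    rw [Fin.sum_univ_succ, card_parts_partition_decomposeFin_symm_zero]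
    simp only [h, Finset.sum_const, Finset.card_univ, Fintype.card_fin, nsmul_eq_mul]
    ring

theorem sum_cycCount {β : Type*} [Fintype β] [DecidableEq β] (π : Equiv.Perm β) :
    ∑ k ∈ Finset.Icc 1 (Fintype.card β), cycCount π k = π.partition.parts.card := by
  have h (k : ℕ) : cycCount π k = π.partition.parts.count k := by
    rw [cycCount, Equiv.Perm.parts_partition, Multiset.count_add, Multiset.count_replicate]
    split_ifs with h₁ h₂ h₂
    · subst h₁
      rw [Multiset.count_eq_zero_of_notMem, zero_add]
      exact fun h => absurd (Equiv.Perm.one_lt_of_mem_cycleType h) (lt_irrefl _)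
    all_goals omega
  simp only [h]
  refine Multiset.sum_count_eq_card fun k hk => Finset.mem_Icc.2 ⟨π.partition.parts_pos hk, ?_⟩
  exact (Multiset.le_sum_of_mem hk).trans_eq π.partition.parts_sum

/-- `Z(S_n; α, α, α, …) = (−1)^n · Ring.choose(−α, n)`, i.e.
`(1/n!) · Σ_{π ∈ S_n} α^{c(π)} = (−1)^n · Ring.choose(−α, n)` where `c(π)` is the total
number of cycles of `π` (fixed points counted as 1-cycles). -/
theorem cycleIndex_symm_const (n : ℕ) (α : ℚ) :
    cycleIndex (⊤ : Subgroup (Equiv.Perm (Fin n))) (fun _ => α) =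
      (-1 : ℚ) ^ n * Ring.choose (-α) n := by
  have hc : Ring.choose (-α) n = (-1) ^ n * Ring.multichoose α n := by
    rw [Ring.choose_neg', Int.negOnePow_def, Units.smul_def]
    simp
  have hm := Ring.factorial_nsmul_multichoose_eq_ascPochhammer α n
  rw [Polynomial.ascPochhammer_smeval_eq_eval, nsmul_eq_mul] at hm
  have hn : (n.factorial : ℚ) ≠ 0 := Nat.cast_ne_zero.2 n.factorial_ne_zero
  rw [hc, ← mul_assoc, ← mul_pow, neg_one_mul, neg_neg, one_pow, one_mul, cycleIndex,
    Subgroup.card_top, Nat.card_perm, Nat.card_fin]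
  simp only [Finset.prod_pow_eq_pow_sum, sum_cycCount, Subgroup.mem_top, Finset.filter_true,
    sum_perm_pow_card_parts_partition, ← hm]
  field_simp
end

section
/- Let g and n be natural numbers. Then the evaluated cycle index Z(S_{2n}; 0, −2g, 0, −2g, …) of the symmetric group S_{2n} at the substitution x(k) = 0 for k odd and x(k) = −2g for k even equals (−1)^n · C(g, n), where C(g, n) is the ordinary binomial coefficient. Equivalently, (1/(2n)!) · Σ_{π ∈ S_{2n}, all cycle lengths of π even} (−2g)^{c(π)} = (−1)^n · C(g, n), where c(π) is the total number of cycles of π. (By Theorem 2 of the paper this value is the signature of the symmetric product SP^{2n}(M_{g,k}) of a genus-g surface with k ≥ 1 punctures.) -/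
/-- The weight `∏ₖ (x k / k) ^ mₖ / mₖ!` of a multiset in which `k` has multiplicity `mₖ`. -/
def multisetWeight (x : ℕ → ℚ) (s : Multiset ℕ) : ℚ :=
  ∏ k ∈ s.toFinset, (x k / k) ^ s.count k / ((s.count k).factorial : ℚ)

/-- The evaluated cycle index of the symmetric group, as a sum over partitions. -/
def partitionSum (x : ℕ → ℚ) (N : ℕ) : ℚ :=
  ∑ p : N.Partition, multisetWeight x p.parts

theorem multisetWeight_eq_prod (x : ℕ → ℚ) {s : Multiset ℕ} {t : Finset ℕ}
    (h : s.toFinset ⊆ t) :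
    multisetWeight x s = ∏ k ∈ t, (x k / k) ^ s.count k / ((s.count k).factorial : ℚ) := by
  refine Finset.prod_subset h fun k _ hk => ?_
  rw [Multiset.mem_toFinset] at hk
  simp [Multiset.count_eq_zero_of_notMem hk]

theorem count_mul_multisetWeight_cons (x : ℕ → ℚ) {k : ℕ} (hk : k ≠ 0) (s : Multiset ℕ) :
    ((k ::ₘ s).count k : ℚ) * k * multisetWeight x (k ::ₘ s) = x k * multisetWeight x s := by
  have hmem : k ∈ (k ::ₘ s).toFinset := by simp
  have hsub : s.toFinset ⊆ (k ::ₘ s).toFinset := by simp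
  rw [multisetWeight_eq_prod x hsub, multisetWeight, ← Finset.mul_prod_erase _ _ hmem,
    ← Finset.mul_prod_erase _ _ hmem]
  have hrest : ∏ j ∈ (k ::ₘ s).toFinset.erase k,
        (x j / j) ^ (k ::ₘ s).count j / (((k ::ₘ s).count j).factorial : ℚ) =
      ∏ j ∈ (k ::ₘ s).toFinset.erase k,
        (x j / j) ^ s.count j / ((s.count j).factorial : ℚ) := by
    refine Finset.prod_congr rfl fun j hj => ?_
    rw [Multiset.count_cons_of_ne (Finset.ne_of_mem_erase hj)]
  rw [hrest, Multiset.count_cons_self, Nat.factorial_succ, pow_succ]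
  have hk' : (k : ℚ) ≠ 0 := by exact_mod_cast hk
  have hf : ((s.count k).factorial : ℚ) ≠ 0 := by exact_mod_cast Nat.factorial_ne_zero _
  have hc : ((s.count k : ℚ) + 1) ≠ 0 := by positivity
  push_cast
  generalize (x k / (k : ℚ)) ^ s.count k = a
  field_simp

theorem sum_count_mul_multisetWeight (x : ℕ → ℚ) {N k : ℕ} (hk : k ≠ 0) (hkN : k ≤ N) :
    ∑ p : N.Partition, (p.parts.count k : ℚ) * k * multisetWeight x p.parts =
      x k * partitionSum x (N - k) := by
  let e : (N - k).Partition → N.Partition := fun q =>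
    { parts := k ::ₘ q.parts
      parts_pos := by
        intro i hi
        rcases Multiset.mem_cons.1 hi with rfl | hi
        · exact Nat.pos_of_ne_zero hk
        · exact q.parts_pos hi
      parts_sum := by rw [Multiset.sum_cons, q.parts_sum]; omega }
  rw [partitionSum, Finset.mul_sum]
  symm
  refine Finset.sum_of_injOn e ?_ (fun _ _ => Finset.mem_coe.2 (Finset.mem_univ _)) ?_ ?_
  · intro q _ r _ h
    exact Nat.Partition.ext ((Multiset.cons_inj_right k).1 (congrArg Nat.Partition.parts h))
  · intro p _ hp
    have hkp : k ∉ p.parts := by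
      intro hkp
      refine hp ⟨⟨p.parts.erase k, fun hi => p.parts_pos (Multiset.mem_of_mem_erase hi), ?_⟩,
        Finset.mem_coe.2 (Finset.mem_univ _), Nat.Partition.ext (Multiset.cons_erase hkp)⟩
      have h := Multiset.sum_erase hkp
      rw [p.parts_sum] at h
      omega
    simp [Multiset.count_eq_zero_of_notMem hkp]
  · intro q _
    exact (count_mul_multisetWeight_cons x hk q.parts).symm

theorem toFinset_parts_subset_Icc {N : ℕ} (p : N.Partition) :
    p.parts.toFinset ⊆ Finset.Icc 1 N := by
  intro k hk
  rw [Multiset.mem_toFinset] at hk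
  exact Finset.mem_Icc.2 ⟨p.parts_pos hk, p.le_of_mem_parts hk⟩

theorem mul_partitionSum (x : ℕ → ℚ) (N : ℕ) :
    (N : ℚ) * partitionSum x N = ∑ k ∈ Finset.Icc 1 N, x k * partitionSum x (N - k) := by
  have h : ∀ k ∈ Finset.Icc 1 N, x k * partitionSum x (N - k) =
      ∑ p : N.Partition, (p.parts.count k : ℚ) * k * multisetWeight x p.parts := by
    intro k hk
    rw [Finset.mem_Icc] at hk
    exact (sum_count_mul_multisetWeight x (by omega) hk.2).symm
  rw [Finset.sum_congr rfl h, Finset.sum_comm, partitionSum, Finset.mul_sum]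
  refine Finset.sum_congr rfl fun p _ => ?_
  rw [← Finset.sum_mul]
  congr 1
  have hs := Finset.sum_multiset_count_of_subset p.parts _ (toFinset_parts_subset_Icc p)
  rw [p.parts_sum] at hs
  exact_mod_cast hs

theorem exists_perm_partition_eq {α : Type*} [Fintype α] [DecidableEq α]
    (p : (Fintype.card α).Partition) : ∃ σ : Equiv.Perm α, σ.partition = p := by
  have hsplit := Multiset.filter_add_not (fun i => 2 ≤ i) p.parts
  have hsum := p.parts_sum
  have hones : p.parts.filter (fun i => ¬ 2 ≤ i) =
      Multiset.replicate (p.parts.filter (fun i => ¬ 2 ≤ i)).card 1 := by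
    refine Multiset.eq_replicate_card.2 fun i hi => ?_
    have := p.parts_pos (Multiset.mem_of_mem_filter hi)
    have := Multiset.of_mem_filter hi
    omega
  rw [hones] at hsplit
  rw [← hsplit, Multiset.sum_add, Multiset.sum_replicate, smul_eq_mul, mul_one] at hsum
  obtain ⟨σ, hσ⟩ := (Equiv.Perm.exists_with_cycleType_iff α
    (m := p.parts.filter (fun i => 2 ≤ i))).2
    ⟨by omega, fun i hi => Multiset.of_mem_filter hi⟩
  refine ⟨σ, Nat.Partition.ext ?_⟩
  rw [Equiv.Perm.parts_partition, ← Equiv.Perm.sum_cycleType, hσ]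
  nth_rewrite 3 [← hsplit]
  congr 2
  omega

theorem card_perm_partition_mul {α : Type*} [Fintype α] [DecidableEq α]
    (p : (Fintype.card α).Partition) :
    (Finset.univ.filter fun σ : Equiv.Perm α => σ.partition = p).card *
      ∏ k ∈ p.parts.toFinset, (k ^ p.parts.count k * (p.parts.count k).factorial) =
      (Fintype.card α).factorial := by
  obtain ⟨σ, rfl⟩ := exists_perm_partition_eq p
  have hcard := Equiv.Perm.card_of_cycleType_mul_eq α σ.cycleType
  rw [if_pos ⟨σ.sum_cycleType_le, fun a ha => Equiv.Perm.two_le_of_mem_cycleType ha⟩] at hcard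
  have hset : (Finset.univ.filter fun τ : Equiv.Perm α => τ.partition = σ.partition) =
      Finset.univ.filter fun τ => τ.cycleType = σ.cycleType := by
    ext τ
    simp only [Finset.mem_filter, Finset.mem_univ, true_and]
    rw [← Equiv.Perm.partition_eq_of_isConj, Equiv.Perm.isConj_iff_cycleType_eq]
  have hprod : σ.partition.parts.prod = σ.cycleType.prod := by
    simp [Equiv.Perm.parts_partition]
  have hone : 1 ∉ σ.cycleType := fun h => by
    have := Equiv.Perm.two_le_of_mem_cycleType h
    omega
  have hsub : σ.partition.parts.toFinset ⊆ insert 1 σ.cycleType.toFinset := by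
    intro k hk
    rw [Multiset.mem_toFinset, Equiv.Perm.parts_partition, Multiset.mem_add] at hk
    rcases hk with hk | hk
    · exact Finset.mem_insert_of_mem (Multiset.mem_toFinset.2 hk)
    · exact Finset.mem_insert.2 (Or.inl (Multiset.eq_of_mem_replicate hk))
  have hfact : ∏ k ∈ σ.partition.parts.toFinset, (σ.partition.parts.count k).factorial =
      (Fintype.card α - σ.cycleType.sum).factorial *
        ∏ k ∈ σ.cycleType.toFinset, (σ.cycleType.count k).factorial := by
    rw [Finset.prod_subset hsub, Finset.prod_insert (by simpa using hone)]
    · congr 1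
      · rw [Equiv.Perm.parts_partition, Multiset.count_add,
          Multiset.count_eq_zero_of_notMem hone, Multiset.count_replicate_self, zero_add,
          Equiv.Perm.sum_cycleType]
      · refine Finset.prod_congr rfl fun k hk => ?_
        have hk1 : 1 ≠ k := by
          rintro rfl
          exact hone (Multiset.mem_toFinset.1 hk)
        rw [Equiv.Perm.parts_partition, Multiset.count_add, Multiset.count_replicate,
          if_neg hk1, add_zero]
    · intro k _ hk
      rw [Multiset.mem_toFinset] at hk
      rw [Multiset.count_eq_zero_of_notMem hk, Nat.factorial_zero]
  rw [hset, Finset.prod_mul_distrib, ← Finset.prod_multiset_count, hprod, hfact, ← hcard]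
  ring

theorem cycCount_eq_count_parts {α : Type*} [Fintype α] [DecidableEq α] (π : Equiv.Perm α)
    (k : ℕ) : cycCount π k = π.partition.parts.count k := by
  rw [cycCount, Equiv.Perm.parts_partition, Multiset.count_add, Multiset.count_replicate]
  split_ifs with h h' h'
  · subst h
    rw [Multiset.count_eq_zero_of_notMem, zero_add]
    intro h
    have := Equiv.Perm.two_le_of_mem_cycleType h
    omega
  · exact absurd h.symm h'
  · exact absurd h'.symm h
  · rw [add_zero]

theorem cycleIndex_top_eq_partitionSum {α : Type*} [Fintype α] [DecidableEq α] (x : ℕ → ℚ) :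
    cycleIndex (⊤ : Subgroup (Equiv.Perm α)) x = partitionSum x (Fintype.card α) := by
  have hN : ((Fintype.card α).factorial : ℚ) ≠ 0 := by
    exact_mod_cast Nat.factorial_ne_zero _
  have hG : Nat.card (⊤ : Subgroup (Equiv.Perm α)) = (Fintype.card α).factorial := by
    rw [Subgroup.card_top, Nat.card_eq_fintype_card, Fintype.card_perm]
  rw [cycleIndex, hG]
  simp only [Subgroup.mem_top, Finset.filter_true, cycCount_eq_count_parts]
  rw [← Finset.sum_fiberwise Finset.univ (fun π : Equiv.Perm α => π.partition), partitionSum,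
    Finset.mul_sum]
  refine Finset.sum_congr rfl fun p _ => ?_
  have hconst : ∀ π ∈ Finset.univ.filter (fun π : Equiv.Perm α => π.partition = p),
      ∏ k ∈ Finset.Icc 1 (Fintype.card α), x k ^ π.partition.parts.count k =
        ∏ k ∈ p.parts.toFinset, x k ^ p.parts.count k := by
    intro π hπ
    rw [(Finset.mem_filter.1 hπ).2]
    refine (Finset.prod_subset (toFinset_parts_subset_Icc p) fun k _ hk => ?_).symm
    rw [Multiset.mem_toFinset] at hk
    rw [Multiset.count_eq_zero_of_notMem hk, pow_zero]
  rw [Finset.sum_congr rfl hconst, Finset.sum_const, nsmul_eq_mul]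
  have hcard := congrArg (Nat.cast : ℕ → ℚ) (card_perm_partition_mul p)
  have hw : multisetWeight x p.parts = (∏ k ∈ p.parts.toFinset, x k ^ p.parts.count k) /
      ((∏ k ∈ p.parts.toFinset, (k ^ p.parts.count k * (p.parts.count k).factorial) : ℕ) : ℚ) := by
    rw [multisetWeight, Nat.cast_prod, ← Finset.prod_div_distrib]
    refine Finset.prod_congr rfl fun k _ => ?_
    rw [div_pow, div_div]
    push_cast
    rfl
  rw [Nat.cast_mul] at hcard
  rw [← hcard] at hN
  rw [hw, ← hcard]
  have h1 := left_ne_zero_of_mul hN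
  have h2 := right_ne_zero_of_mul hN
  field_simp

theorem sum_neg_one_pow_mul_choose (g n : ℕ) :
    -(g : ℚ) * ∑ i ∈ Finset.range n, (-1 : ℚ) ^ i * (g.choose i : ℚ) =
      n * ((-1 : ℚ) ^ n * (g.choose n : ℚ)) := by
  induction n with
  | zero => simp
  | succ n ih =>
    have h : (g.choose (n + 1) : ℚ) * (n + 1) = g.choose n * (g - n) := by
      rcases le_or_gt n g with hn | hn
      · have := congrArg (Nat.cast : ℕ → ℚ) (Nat.choose_succ_right_eq g n)
        rw [Nat.cast_mul, Nat.cast_mul, Nat.cast_sub hn] at this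
        exact_mod_cast this
      · simp [Nat.choose_eq_zero_of_lt hn, Nat.choose_eq_zero_of_lt (hn.trans n.lt_succ_self)]
    rw [Finset.sum_range_succ, mul_add, ih]
    push_cast
    rw [pow_succ]
    linear_combination (-1 : ℚ) ^ n * h

theorem sum_Icc_ite_odd (c : ℚ) (f : ℕ → ℚ) (n : ℕ) :
    ∑ k ∈ Finset.Icc 1 (2 * n), (if Odd k then 0 else c) * f (2 * n - k) =
      c * ∑ i ∈ Finset.range n, f (2 * i) := by
  rw [Finset.mul_sum]
  symm
  refine Finset.sum_of_injOn (fun i => 2 * n - 2 * i) ?_ ?_ ?_ ?_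
  · intro i hi j hj h
    simp only [Finset.coe_range, Set.mem_Iio] at hi hj h
    omega
  · intro i hi
    simp only [Finset.coe_range, Set.mem_Iio, Finset.coe_Icc, Set.mem_Icc] at hi ⊢
    omega
  · intro k hk hk'
    rw [if_pos, zero_mul]
    by_contra hodd
    obtain ⟨j, hj⟩ := Nat.not_odd_iff_even.1 hodd
    rw [Finset.mem_Icc] at hk
    refine hk' ⟨n - j, ?_, ?_⟩
    · simp only [Finset.coe_range, Set.mem_Iio]
      omega
    · dsimp only
      omega
  · intro i hi
    rw [Finset.mem_range] at hi
    have hodd : ¬ Odd (2 * n - 2 * i) := by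
      rw [Nat.not_odd_iff_even]
      exact ⟨n - i, by omega⟩
    rw [if_neg hodd]
    congr 2
    omega

theorem partitionSum_neg_two_mul (g n : ℕ) :
    partitionSum (fun k => if Odd k then 0 else -(2 * g : ℚ)) (2 * n) =
      (-1 : ℚ) ^ n * (g.choose n : ℚ) := by
  induction n using Nat.strong_induction_on with
  | _ n ih =>
    rcases Nat.eq_zero_or_pos n with rfl | hn
    · simp [partitionSum, multisetWeight, Subsingleton.elim _ (default : Nat.Partition 0)]
    · have hrec := mul_partitionSum (fun k => if Odd k then 0 else -(2 * g : ℚ)) (2 * n)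
      rw [sum_Icc_ite_odd, Finset.sum_congr rfl fun i hi => ih i (Finset.mem_range.1 hi)] at hrec
      have hn' : (n : ℚ) ≠ 0 := by exact_mod_cast hn.ne'
      refine mul_left_cancel₀ hn' ?_
      rw [← sum_neg_one_pow_mul_choose]
      push_cast at hrec
      linear_combination hrec / 2

/-- `Z(S_{2n}; 0, −2g, 0, −2g, …) = (−1)^n · C(g, n)`.  (This is the
signature of the symmetric product `SP^{2n}(M_{g,k})` of a punctured genus-`g` surface.) -/
theorem cycleIndex_symm_neg_two_g (g n : ℕ) :
    cycleIndex (⊤ : Subgroup (Equiv.Perm (Fin (2 * n))))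
        (fun k => if Odd k then 0 else -(2 * g : ℚ)) =
      (-1 : ℚ) ^ n * (g.choose n : ℚ) := by
  rw [cycleIndex_top_eq_partitionSum, Fintype.card_fin, partitionSum_neg_two_mul]
end

section
/- (Pólya's wreath product formula for the cycle index, evaluated form.) Let k, m ≥ 1, let H be a subgroup of the group of permutations of Fin m, and let G be the wreath product S_k ≀ H realized as the subgroup of permutations of Fin k × Fin m consisting of all σ for which there exist a permutation ρ of Fin k and a function τ : Fin k → H with σ(i, j) = (ρ(i), τ(i)(j)) for all (i, j). Then for every function x : ℕ → ℚ, the evaluated cycle index of G satisfies Z(G; x) = (1/k!) · Σ_{ρ ∈ S_k} Π_{j=1}^{k} y(j)^{c_j(ρ)}, where y(j) := (1/|H|) · Σ_{τ ∈ H} Π_{r=1}^{m} x(j·r)^{c_r(τ)}; that is, Z(S_k ≀ H; x₁, x₂, …) = Z(S_k; Z(H; x₁, x₂, …), Z(H; x₂, x₄, …), …, Z(H; x_k, x_{2k}, …)). -/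
/- The wreath product `S_k ≀ H`, realized as the subgroup of the permutations of
`Fin k × Fin m` consisting of all `σ` for which there exist a permutation `ρ` of `Fin k`
and a function `τ : Fin k → H` with `σ (i, j) = (ρ i, τ i j)` for all `(i, j)`. -/
def wreath (k m : ℕ) (H : Subgroup (Equiv.Perm (Fin m))) :
    Subgroup (Equiv.Perm (Fin k × Fin m)) where
  carrier := {σ | ∃ (ρ : Equiv.Perm (Fin k)) (τ : Fin k → H),
    ∀ i j, σ (i, j) = (ρ i, (τ i : Equiv.Perm (Fin m)) j)}
  one_mem' := ⟨1, fun _ => 1, fun _ _ => rfl⟩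
  mul_mem' := by
    rintro σ₁ σ₂ ⟨ρ₁, τ₁, h₁⟩ ⟨ρ₂, τ₂, h₂⟩
    refine ⟨ρ₁ * ρ₂, fun i => τ₁ (ρ₂ i) * τ₂ i, fun i j => ?_⟩
    simp [Equiv.Perm.mul_apply, h₂, h₁]
  inv_mem' := by
    rintro σ ⟨ρ, τ, h⟩
    refine ⟨ρ⁻¹, fun i => (τ (ρ⁻¹ i))⁻¹, fun i j => ?_⟩
    rw [Equiv.Perm.inv_def, Equiv.symm_apply_eq, h]
    simp

open Equiv Equiv.Perm Function

section Orbits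

variable {α : Type*}

theorem Equiv.Perm.pow_apply_eq_self_iff_minimalPeriod_dvd (π : Perm α) (a : α) (n : ℕ) :
    (π ^ n) a = a ↔ minimalPeriod π a ∣ n := by
  rw [← isPeriodicPt_iff_minimalPeriod_dvd, IsPeriodicPt, IsFixedPt, iterate_eq_pow]

/-- The set of orbits of a permutation. -/
abbrev Equiv.Perm.Orbits (π : Perm α) : Type _ := Quotient (SameCycle.setoid π)

theorem Equiv.Perm.Orbits.mk_eq_iff {π : Perm α} {a b : α} :
    (Quotient.mk _ a : π.Orbits) = Quotient.mk _ b ↔ π.SameCycle a b :=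
  Quotient.eq

theorem Equiv.Perm.Orbits.sameCycle_out_mk (π : Perm α) (a : α) :
    π.SameCycle (Quotient.mk _ a : π.Orbits).out a :=
  Quotient.mk_out (s := SameCycle.setoid π) a

variable [Finite α]

theorem Equiv.Perm.minimalPeriod_pos (π : Perm α) (a : α) : 0 < minimalPeriod π a :=
  minimalPeriod_pos_of_mem_periodicPts (π.injective.mem_periodicPts a)

theorem Equiv.Perm.SameCycle.exists_nat_pow_apply_eq {π : Perm α} {a b : α}
    (h : π.SameCycle a b) : ∃ n : ℕ, (π ^ n) a = b := by
  obtain ⟨n, -, hn⟩ := h.exists_pow_eq'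
  exact ⟨n, hn⟩

theorem Equiv.Perm.SameCycle.minimalPeriod_eq {π : Perm α} {a b : α} (h : π.SameCycle a b) :
    minimalPeriod π a = minimalPeriod π b := by
  obtain ⟨n, rfl⟩ := h.exists_nat_pow_apply_eq
  rw [← iterate_eq_pow, minimalPeriod_apply_iterate (π.injective.mem_periodicPts a)]

noncomputable instance (π : Perm α) : Fintype π.Orbits := Fintype.ofFinite _

/-- The product over the orbits of `π` of `x ℓ`, where `ℓ` is the length of the orbit. -/
noncomputable def orbitWeight (π : Perm α) (x : ℕ → ℚ) : ℚ :=
  ∏ O : π.Orbits, x (minimalPeriod π O.out)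

end Orbits

section CycleType

variable {α : Type*} [Fintype α] [DecidableEq α]

theorem Equiv.Perm.minimalPeriod_eq_card_support_cycleOf (π : Perm α) {a : α}
    (ha : a ∈ π.support) : minimalPeriod π a = (π.cycleOf a).support.card := by
  have h : a ∈ (π.cycleOf a).support := (mem_support_cycleOf_iff' (mem_support.1 ha)).2
    (SameCycle.refl _ _)
  refine Nat.dvd_right_iff_eq.1 fun n => ?_
  rw [← pow_apply_eq_self_iff_minimalPeriod_dvd,
    (isCycleOn_support_cycleOf π a).pow_apply_eq h]

theorem prod_pow_cycCount (π : Perm α) (x : ℕ → ℚ) :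
    ∏ k ∈ Finset.Icc 1 (Fintype.card α), x k ^ cycCount π k =
      x 1 ^ (Fintype.card α - π.support.card) * (π.cycleType.map x).prod := by
  have h_type : (π.cycleType.map x).prod =
      ∏ k ∈ Finset.Icc 1 (Fintype.card α), x k ^ π.cycleType.count k := by
    rw [Finset.prod_multiset_map_count]
    refine Finset.prod_subset (fun k hk => ?_) fun k _ hk => by
      rw [Multiset.count_eq_zero.2 (Multiset.mem_toFinset.not.1 hk), pow_zero]
    rw [Multiset.mem_toFinset] at hk
    exact Finset.mem_Icc.2 ⟨(one_lt_of_mem_cycleType hk).le,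
      (le_card_support_of_mem_cycleType hk).trans (Finset.card_le_univ _)⟩
  have h_one : π.cycleType.count 1 = 0 :=
    Multiset.count_eq_zero.2 fun h => (one_lt_of_mem_cycleType h).ne rfl
  rcases Nat.eq_zero_or_pos (Fintype.card α) with h | h
  · rw [h_type]; simp [h]
  · have h1 : 1 ∈ Finset.Icc 1 (Fintype.card α) := Finset.mem_Icc.2 ⟨le_rfl, h⟩
    rw [h_type, ← Finset.mul_prod_erase _ _ h1, ← Finset.mul_prod_erase _ _ h1, h_one, pow_zero,
      one_mul, cycCount, if_pos rfl]
    refine congrArg _ (Finset.prod_congr rfl fun k hk => ?_)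
    simp [cycCount, Finset.ne_of_mem_erase hk]

theorem orbitWeight_eq_prod_pow_cycCount (π : Perm α) (x : ℕ → ℚ) :
    orbitWeight π x = ∏ k ∈ Finset.Icc 1 (Fintype.card α), x k ^ cycCount π k := by
  classical
  rw [prod_pow_cycCount, orbitWeight,
    ← Finset.prod_filter_not_mul_prod_filter Finset.univ fun O : π.Orbits => O.out ∈ π.support]
  congr 1
  · have h_fixed : ∀ O ∈ Finset.univ.filter (fun O : π.Orbits => O.out ∉ π.support),
        x (minimalPeriod π O.out) = x 1 := fun O hO => by
      rw [minimalPeriod_eq_one_iff_isFixedPt.2 (notMem_support.1 (Finset.mem_filter.1 hO).2)]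
    rw [Finset.prod_congr rfl h_fixed, Finset.prod_const, ← Finset.card_compl]
    congr 1
    refine Finset.card_bij (fun O _ => O.out) ?_ (fun _ _ _ _ h => Quotient.out_injective h) ?_
    · intro O hO
      simpa using hO
    · intro a ha
      have ha' : π a = a := by simpa using ha
      have h_out : (Quotient.mk _ a : π.Orbits).out = a :=
        ((Orbits.sameCycle_out_mk π a).symm.eq_of_left ha').symm
      refine ⟨Quotient.mk _ a, ?_, h_out⟩
      simp [h_out, ha']
  · rw [cycleType_def, Multiset.map_map]
    refine Finset.prod_bij (fun O _ => π.cycleOf O.out) ?_ ?_ ?_ ?_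
    · intro O hO
      exact cycleOf_mem_cycleFactorsFinset_iff.2 (Finset.mem_filter.1 hO).2
    · intro O hO O' hO' h
      have := (sameCycle_iff_cycleOf_eq_of_mem_support (Finset.mem_filter.1 hO).2
        (Finset.mem_filter.1 hO').2).2 h
      rw [← O.out_eq, ← O'.out_eq]
      exact Orbits.mk_eq_iff.2 this
    · intro c hc
      obtain ⟨a, ha⟩ := (mem_cycleFactorsFinset_iff.1 hc).1.nonempty_support
      have h_same := Orbits.sameCycle_out_mk π a
      have h_cycle : π.cycleOf (Quotient.mk _ a : π.Orbits).out = c := by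
        rw [h_same.cycleOf_eq, cycle_is_cycleOf ha hc]
      refine ⟨Quotient.mk _ a, ?_, h_cycle⟩
      rw [Finset.mem_filter, ← cycleOf_mem_cycleFactorsFinset_iff, h_cycle]
      exact ⟨Finset.mem_univ _, hc⟩
    · intro O hO
      rw [minimalPeriod_eq_card_support_cycleOf π (Finset.mem_filter.1 hO).2]
      rfl

theorem cycleIndex_eq_sum_orbitWeight (G : Subgroup (Perm α)) [Fintype G] (x : ℕ → ℚ) :
    cycleIndex G x = 1 / (Fintype.card G : ℚ) * ∑ π : G, orbitWeight (π : Perm α) x := by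
  classical
  rw [cycleIndex, Nat.card_eq_fintype_card]
  congr 1
  simp_rw [orbitWeight_eq_prod_pow_cycCount]
  exact Finset.sum_subtype _ (by simp) _

end CycleType

section Cocycle

variable {B F : Type*}

/-- The permutation `(i, f) ↦ (ρ i, τ i f)` of `B × F`. -/
abbrev shearPerm (ρ : Perm B) (τ : B → Perm F) : Perm (B × F) := prodShear ρ τ

/-- The permutation of the second factor by which the `n`-th power of `shearPerm ρ τ` maps the
fibre over `i` to the fibre over `(ρ ^ n) i`, for coefficients in an arbitrary group. -/
def shearCocycle {Γ : Type*} [Group Γ] (ρ : Perm B) (τ : B → Γ) : ℕ → B → Γ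
  | 0, _ => 1
  | n + 1, i => shearCocycle ρ τ n (ρ i) * τ i

theorem shearCocycle_congr {Γ : Type*} [Group Γ] (ρ : Perm B) {τ τ' : B → Γ} (n : ℕ) (i : B)
    (h : ∀ t < n, τ ((ρ ^ t) i) = τ' ((ρ ^ t) i)) :
    shearCocycle ρ τ n i = shearCocycle ρ τ' n i := by
  induction n generalizing i with
  | zero => rfl
  | succ n ih =>
    rw [shearCocycle, shearCocycle, ih (ρ i) fun t ht => h (t + 1) (by omega)]
    exact congrArg _ (h 0 (by omega))

theorem map_shearCocycle {Γ Γ' : Type*} [Group Γ] [Group Γ'] (φ : Γ →* Γ') (ρ : Perm B)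
    (τ : B → Γ) (n : ℕ) (i : B) :
    φ (shearCocycle ρ τ n i) = shearCocycle ρ (fun i => φ (τ i)) n i := by
  induction n generalizing i with
  | zero => exact map_one φ
  | succ n ih => rw [shearCocycle, shearCocycle, map_mul, ih]

theorem shearPerm_pow_apply (ρ : Perm B) (τ : B → Perm F) (n : ℕ) (i : B) (f : F) :
    ((shearPerm ρ τ) ^ n) (i, f) = ((ρ ^ n) i, shearCocycle ρ τ n i f) := by
  induction n generalizing i f with
  | zero => rfl
  | succ n ih => rw [pow_succ, mul_apply, pow_succ, mul_apply]; exact ih _ _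

theorem shearCocycle_mul {Γ : Type*} [Group Γ] (ρ : Perm B) (τ : B → Γ) {p : ℕ} {i : B}
    (hp : (ρ ^ p) i = i) (t : ℕ) :
    shearCocycle ρ τ (p * t) i = shearCocycle ρ τ p i ^ t := by
  have h_add : ∀ (a b : ℕ) (j : B), shearCocycle ρ τ (a + b) j =
      shearCocycle ρ τ a ((ρ ^ b) j) * shearCocycle ρ τ b j := by
    intro a b
    induction b with
    | zero => intro j; simp [shearCocycle]
    | succ b ih => intro j; rw [← add_assoc, shearCocycle, ih, shearCocycle, mul_assoc]; rfl
  induction t with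
  | zero => simp [shearCocycle]
  | succ t ih => rw [mul_add, mul_one, h_add, hp, ih, pow_succ]

end Cocycle

section Shear

variable {B F : Type*}

/-- The permutation of the fibre over the representative of the orbit `O` of `ρ` induced by the
first power of `shearPerm ρ τ` preserving that fibre. -/
noncomputable def returnMap {Γ : Type*} [Group Γ] (ρ : Perm B) (τ : B → Γ) (O : ρ.Orbits) : Γ :=
  shearCocycle ρ τ (minimalPeriod ρ O.out) O.out

theorem shearPerm_pow_mul_apply_out (ρ : Perm B) (τ : B → Perm F) (O : ρ.Orbits) (t : ℕ) (f : F) :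
    ((shearPerm ρ τ) ^ (minimalPeriod ρ O.out * t)) (O.out, f) =
      (O.out, (returnMap ρ τ O ^ t) f) := by
  rw [shearPerm_pow_apply, (pow_apply_eq_self_iff_minimalPeriod_dvd ρ _ _).2 (dvd_mul_right _ _),
    shearCocycle_mul ρ τ ((pow_apply_eq_self_iff_minimalPeriod_dvd ρ _ _).2 dvd_rfl), returnMap]

theorem minimalPeriod_shearPerm (ρ : Perm B) (τ : B → Perm F) (O : ρ.Orbits) (f : F) :
    minimalPeriod (shearPerm ρ τ) (O.out, f) =
      minimalPeriod ρ O.out * minimalPeriod (returnMap (Γ := Perm F) ρ τ O) f := by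
  refine Nat.dvd_right_iff_eq.1 fun n => ?_
  have h_base : ((shearPerm ρ τ) ^ n) (O.out, f) = (O.out, f) →
      minimalPeriod ρ O.out ∣ n := fun h => by
    rw [shearPerm_pow_apply] at h
    exact (pow_apply_eq_self_iff_minimalPeriod_dvd ρ _ _).1 (congrArg Prod.fst h)
  have h_iff : ∀ t, ((shearPerm ρ τ) ^ (minimalPeriod ρ O.out * t)) (O.out, f) =
      (O.out, f) ↔ minimalPeriod (returnMap (Γ := Perm F) ρ τ O) f ∣ t := fun t => by
    rw [shearPerm_pow_mul_apply_out, Prod.mk_right_inj, pow_apply_eq_self_iff_minimalPeriod_dvd]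
  rw [← pow_apply_eq_self_iff_minimalPeriod_dvd]
  constructor
  · intro h
    obtain ⟨t, rfl⟩ := h_base h
    exact mul_dvd_mul_left _ ((h_iff t).1 h)
  · rintro ⟨t, rfl⟩
    rw [mul_assoc]
    exact (h_iff _).2 (dvd_mul_right _ _)

variable [Finite B] [Finite F]

/-- The orbit of `shearPerm ρ τ` through a given orbit of a return map. -/
noncomputable def orbitOfReturnMap (ρ : Perm B) (τ : B → Perm F)
    (P : Σ O : ρ.Orbits, (returnMap ρ τ O).Orbits) : (shearPerm ρ τ).Orbits :=
  Quotient.mk _ (P.1.out, P.2.out)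

theorem orbitOfReturnMap_bijective (ρ : Perm B) (τ : B → Perm F) :
    Bijective (orbitOfReturnMap ρ τ) := by
  constructor
  · rintro ⟨O, Q⟩ ⟨O', Q'⟩ h
    obtain ⟨n, hn⟩ := (Orbits.mk_eq_iff.1 h).exists_nat_pow_apply_eq
    have h_fst : (ρ ^ n) O.out = O'.out := by
      rw [shearPerm_pow_apply] at hn
      exact congrArg Prod.fst hn
    obtain rfl : O = O' := by
      rw [← O.out_eq, ← O'.out_eq]
      exact Orbits.mk_eq_iff.2 ⟨n, by rw [zpow_natCast, h_fst]⟩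
    obtain ⟨t, rfl⟩ := (pow_apply_eq_self_iff_minimalPeriod_dvd ρ _ _).1 h_fst
    rw [shearPerm_pow_mul_apply_out] at hn
    obtain rfl : Q = Q' := by
      rw [← Q.out_eq, ← Q'.out_eq]
      exact Orbits.mk_eq_iff.2 ⟨t, by rw [zpow_natCast]; exact congrArg Prod.snd hn⟩
    rfl
  · intro R
    obtain ⟨⟨i, f⟩, rfl⟩ := R.exists_rep
    set O : ρ.Orbits := Quotient.mk _ i
    obtain ⟨n, hn⟩ := (Orbits.sameCycle_out_mk ρ i).symm.exists_nat_pow_apply_eq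
    set Q : (returnMap ρ τ O).Orbits := Quotient.mk _ (shearCocycle ρ τ n i f)
    obtain ⟨t, ht⟩ := (Orbits.sameCycle_out_mk (returnMap ρ τ O)
      (shearCocycle ρ τ n i f)).exists_nat_pow_apply_eq
    refine ⟨⟨O, Q⟩, Orbits.mk_eq_iff.2 ?_⟩
    have h_fibre : (shearPerm ρ τ).SameCycle (O.out, Q.out)
        (O.out, shearCocycle ρ τ n i f) :=
      ⟨(minimalPeriod ρ O.out * t : ℕ), by
        rw [zpow_natCast, shearPerm_pow_mul_apply_out, ht]⟩
    refine h_fibre.trans (SameCycle.symm ⟨n, ?_⟩)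
    rw [zpow_natCast, shearPerm_pow_apply, hn]

theorem orbitWeight_shearPerm (ρ : Perm B) (τ : B → Perm F) (x : ℕ → ℚ) :
    orbitWeight (shearPerm ρ τ) x =
      ∏ O : ρ.Orbits, orbitWeight (returnMap ρ τ O) fun r => x (minimalPeriod ρ O.out * r) := by
  simp_rw [orbitWeight]
  rw [← (orbitOfReturnMap_bijective ρ τ).prod_comp, Fintype.prod_sigma]
  refine Finset.prod_congr rfl fun O _ => Finset.prod_congr rfl fun Q _ => ?_
  rw [← minimalPeriod_shearPerm]
  exact congrArg x (Orbits.sameCycle_out_mk (shearPerm ρ τ) _).minimalPeriod_eq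

end Shear

section Sum

variable {B Γ : Type*} [Group Γ]

open scoped Classical in
/-- Replace the value of `τ` at each orbit representative by the return map of the orbit. -/
noncomputable def returnTwist (ρ : Perm B) (τ : B → Γ) (i : B) : Γ :=
  if (Quotient.mk _ i : ρ.Orbits).out = i then returnMap ρ τ (Quotient.mk _ i) else τ i

theorem returnTwist_out (ρ : Perm B) (τ : B → Γ) (O : ρ.Orbits) :
    returnTwist ρ τ O.out = returnMap ρ τ O := by
  rw [returnTwist, Quotient.out_eq, if_pos rfl]

theorem returnTwist_injective [Finite B] (ρ : Perm B) : Injective (returnTwist (Γ := Γ) ρ) := by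
  intro τ τ' h
  have h_off : ∀ i, (Quotient.mk _ i : ρ.Orbits).out ≠ i → τ i = τ' i := fun i hi => by
    simpa [returnTwist, hi] using congrFun h i
  have h_out : ∀ O : ρ.Orbits, τ O.out = τ' O.out := fun O => by
    have hO := congrFun h O.out
    rw [returnTwist_out, returnTwist_out, returnMap, returnMap] at hO
    obtain ⟨p, hp⟩ := Nat.exists_eq_succ_of_ne_zero (ρ.minimalPeriod_pos O.out).ne'
    rw [hp, shearCocycle, shearCocycle, shearCocycle_congr ρ p (ρ O.out) fun t ht => ?_] at hO
    · exact mul_left_cancel hO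
    · rw [← mul_apply, ← pow_succ]
      refine h_off _ fun h_rep => ?_
      have h_mk : (Quotient.mk _ ((ρ ^ (t + 1)) O.out) : ρ.Orbits) = O := by
        conv_rhs => rw [← O.out_eq]
        exact Orbits.mk_eq_iff.2 (SameCycle.symm ⟨(t + 1 : ℕ), by rw [zpow_natCast]⟩)
      rw [h_mk] at h_rep
      have h_le := Nat.le_of_dvd t.succ_pos
        ((pow_apply_eq_self_iff_minimalPeriod_dvd ρ _ _).1 h_rep.symm)
      omega
  funext i
  by_cases hi : (Quotient.mk _ i : ρ.Orbits).out = i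
  · rw [← hi]
    exact h_out _
  · exact h_off i hi

theorem sum_prod_returnMap [Fintype B] [DecidableEq B] [Fintype Γ] (ρ : Perm B)
    (g : ρ.Orbits → Γ → ℚ) :
    1 / (Fintype.card Γ : ℚ) ^ Fintype.card B * ∑ τ : B → Γ, ∏ O, g O (returnMap ρ τ O) =
      ∏ O, (1 / (Fintype.card Γ : ℚ) * ∑ γ, g O γ) := by
  classical
  have h_orbits : ∀ u : B → ℚ, ∏ O : ρ.Orbits, u O.out =
      ∏ i, if (Quotient.mk _ i : ρ.Orbits).out = i then u i else 1 := fun u => by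
    rw [← Finset.prod_filter]
    refine Finset.prod_bij (fun O _ => O.out) (by simp)
      (fun _ _ _ _ h => Quotient.out_injective h) ?_ (fun _ _ => rfl)
    intro i hi
    exact ⟨Quotient.mk _ i, Finset.mem_univ _, (Finset.mem_filter.1 hi).2⟩
  have h_card : (Fintype.card Γ : ℚ) ≠ 0 := Nat.cast_ne_zero.2 Fintype.card_ne_zero
  have h_twist : ∀ τ : B → Γ, ∏ O, g O (returnMap ρ τ O) =
      ∏ i, if (Quotient.mk _ i : ρ.Orbits).out = i then
        g (Quotient.mk _ i) (returnTwist ρ τ i) else 1 := fun τ => by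
    rw [← h_orbits fun i => g (Quotient.mk _ i) (returnTwist ρ τ i)]
    simp_rw [returnTwist_out, Quotient.out_eq]
  have h_rhs := h_orbits fun i => 1 / (Fintype.card Γ : ℚ) * ∑ γ, g (Quotient.mk _ i) γ
  simp_rw [Quotient.out_eq] at h_rhs
  simp_rw [h_twist]
  rw [h_rhs, (Finite.injective_iff_bijective.1 (returnTwist_injective ρ)).sum_comp
      (fun τ : B → Γ => ∏ i, if (Quotient.mk _ i : ρ.Orbits).out = i then
        g (Quotient.mk _ i) (τ i) else 1),
    ← Fintype.piFinset_univ, ← Finset.prod_univ_sum (fun _ => Finset.univ)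
      (fun i γ => if (Quotient.mk _ i : ρ.Orbits).out = i then g (Quotient.mk _ i) γ else 1),
    ← one_div_pow, ← Finset.card_univ (α := B), ← Finset.prod_const, ← Finset.prod_mul_distrib]
  refine Finset.prod_congr rfl fun i _ => ?_
  split_ifs with hi
  · rfl
  · simp [h_card]

end Sum

/-- Elements of the wreath product correspond to pairs `(ρ, τ)`. -/
noncomputable def wreathEquiv (k m : ℕ) (hm : 1 ≤ m) (H : Subgroup (Perm (Fin m))) :
    Perm (Fin k) × (Fin k → H) ≃ wreath k m H :=
  Equiv.ofBijective
    (fun p => ⟨shearPerm p.1 fun i => (p.2 i : Perm (Fin m)), p.1, p.2, fun _ _ => rfl⟩) <| by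
    constructor
    · rintro ⟨ρ, τ⟩ ⟨ρ', τ'⟩ h
      have h_apply : ∀ i j, (ρ i, (τ i : Perm (Fin m)) j) = (ρ' i, (τ' i : Perm (Fin m)) j) :=
        fun i j => Equiv.congr_fun (congrArg Subtype.val h) (i, j)
      refine Prod.ext (Equiv.ext fun i => congrArg Prod.fst (h_apply i ⟨0, hm⟩)) (funext fun i => ?_)
      exact Subtype.ext (Equiv.ext fun j => congrArg Prod.snd (h_apply i j))
    · rintro ⟨σ, ρ, τ, h⟩
      exact ⟨(ρ, τ), Subtype.ext (Equiv.ext fun p => (h p.1 p.2).symm)⟩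

/-- Pólya'\''s wreath product formula, evaluated form:
`Z(S_k ≀ H; x₁, x₂, …) = Z(S_k; Z(H; x₁, x₂, …), Z(H; x₂, x₄, …), …, Z(H; x_k, x_{2k}, …))`,
i.e. the evaluated cycle index of the wreath product at `x` equals the evaluated cycle
index of `S_k` at the variables `y(j) = Z(H; x_j, x_{2j}, …)`. -/
theorem cycleIndex_wreath (k m : ℕ) (hk : 1 ≤ k) (hm : 1 ≤ m)
    (H : Subgroup (Equiv.Perm (Fin m))) (x : ℕ → ℚ) :
    cycleIndex (wreath k m H) x =
      cycleIndex (⊤ : Subgroup (Equiv.Perm (Fin k)))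
        (fun j => cycleIndex H (fun r => x (j * r))) := by
  classical
  rw [cycleIndex_eq_sum_orbitWeight, cycleIndex_eq_sum_orbitWeight ⊤,
    ← (wreathEquiv k m hm H).sum_comp, ← Fintype.card_congr (wreathEquiv k m hm H),
    ← (Subgroup.topEquiv (G := Perm (Fin k))).symm.toEquiv.sum_comp,
    ← Fintype.card_congr (Subgroup.topEquiv (G := Perm (Fin k))).symm.toEquiv,
    Fintype.sum_prod_type, Fintype.card_prod, Fintype.card_fun, Nat.cast_mul, Nat.cast_pow,
    ← one_div_mul_one_div, mul_assoc, Finset.mul_sum]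
  congr 1
  refine Finset.sum_congr rfl fun ρ _ => ?_
  have h_weight : ∀ τ : Fin k → H,
      orbitWeight (wreathEquiv k m hm H (ρ, τ) : Perm (Fin k × Fin m)) x =
        ∏ O : ρ.Orbits, orbitWeight ((returnMap ρ τ O : H) : Perm (Fin m))
          fun r => x (minimalPeriod ρ O.out * r) := fun τ => by
    refine (orbitWeight_shearPerm ρ (fun i => (τ i : Perm (Fin m))) x).trans
      (Finset.prod_congr rfl fun O _ => ?_)
    exact congrArg (orbitWeight · _) (map_shearCocycle H.subtype ρ τ _ _).symm
  simp_rw [h_weight]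
  rw [sum_prod_returnMap ρ fun O (γ : H) =>
    orbitWeight (γ : Perm (Fin m)) fun r => x (minimalPeriod ρ O.out * r)]
  simp_rw [← cycleIndex_eq_sum_orbitWeight]
  rfl
end

section
/- Let m be an odd positive integer and g a natural number. Let G = S_2 ≀ S_m be the wreath product, realized as the subgroup of permutations of Fin 2 × Fin m consisting of all σ for which there exist a permutation ρ of Fin 2 and a function τ : Fin 2 → S_m with σ(i, j) = (ρ(i), τ(i)(j)). Then the evaluated cycle index of G at the substitution x(k) = 0 for k odd and x(k) = −2g for k even satisfies Z(S_2 ≀ S_m; 0, −2g, 0, −2g, …) = −(1/2) · C(2g, m), where C(2g, m) is the ordinary binomial coefficient. (By Theorem 2 of the paper this value is the signature of the iterated symmetric product SP²(SP^m(M_{g,k})) for k ≥ 1.) -/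
open Equiv Equiv.Perm Finset

theorem eq_of_sameCycle {α β : Type*} [Finite α] {π : Perm α} {f : α → β}
    (hf : ∀ x, f (π x) = f x) {x y : α}
    (h : π.SameCycle x y) : f x = f y := by
  obtain ⟨n, rfl⟩ := h.exists_nat_pow_eq
  induction n with
  | zero => rfl
  | succ n ih =>
    rw [pow_succ', mul_apply, hf]
    exact ih ⟨n, by simp⟩

theorem exists_odd_pow_apply_eq {α : Type*} [Fintype α] (hodd : Odd (Fintype.card α)) (π : Perm α) :
    ∃ n, Odd n ∧ ∃ x, (π ^ n) x = x := by
  obtain ⟨a, b, hb, hab⟩ := Nat.exists_eq_two_pow_mul_odd (orderOf_pos π).ne'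
  refine ⟨b, hb, ?_⟩
  have : Fact (Nat.Prime 2) := ⟨Nat.prime_two⟩
  refine exists_fixed_point_of_prime (p := 2) (n := a) ?_ ?_
  · rwa [← even_iff_two_dvd, Nat.not_even_iff_odd]
  · rw [← pow_mul, mul_comm, ← hab, pow_orderOf_eq_one]

section Orbits

variable {α : Type*} [Fintype α] [DecidableEq α]

/-- The number of cycles of a permutation, fixed points included. -/
def numCycles (π : Perm α) : ℕ :=
  Fintype.card α - π.support.card + π.cycleType.card

/-- The cycle of `π` through `x`, with a fixed point represented by itself. -/
def cycleKey (π : Perm α) (x : α) : Perm α ⊕ α :=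
  if π x = x then Sum.inr x else Sum.inl (π.cycleOf x)

theorem cycleKey_eq_iff (π : Perm α) (x y : α) :
    cycleKey π x = cycleKey π y ↔ π.SameCycle x y := by
  unfold cycleKey
  constructor
  · split_ifs with hx hy hy
    · simp only [Sum.inr.injEq]
      rintro rfl
      exact SameCycle.refl _ _
    · simp
    · simp
    · simp only [Sum.inl.injEq]
      intro h
      exact (sameCycle_iff_cycleOf_eq_of_mem_support (mem_support.2 hx) (mem_support.2 hy)).2 h
  · intro h
    by_cases hx : π x = x
    · obtain rfl := h.eq_of_left hx
      rfl
    · have hy : π y ≠ y := fun hy => hx (h.apply_eq_self_iff.2 hy)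
      rw [if_neg hx, if_neg hy, h.cycleOf_eq]

theorem image_cycleKey (π : Perm α) :
    univ.image (cycleKey π) = π.cycleFactorsFinset.disjSum π.supportᶜ := by
  ext (c | x)
  · simp only [mem_image, mem_univ, true_and, inl_mem_disjSum]
    constructor
    · rintro ⟨x, hx⟩
      unfold cycleKey at hx
      split_ifs at hx with h
      rw [← Sum.inl.inj hx, cycleOf_mem_cycleFactorsFinset_iff, mem_support]
      exact h
    · intro hc
      obtain ⟨x, hx⟩ := (mem_cycleFactorsFinset_iff.1 hc).1.nonempty_support
      have hx' := mem_cycleFactorsFinset_support_le hc hx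
      refine ⟨x, ?_⟩
      rw [cycleKey, if_neg (mem_support.1 hx'), cycle_is_cycleOf hx hc]
  · simp only [mem_image, mem_univ, true_and, inr_mem_disjSum, mem_compl, notMem_support]
    constructor
    · rintro ⟨y, hy⟩
      unfold cycleKey at hy
      split_ifs at hy with h
      rwa [← Sum.inr.inj hy]
    · intro h
      exact ⟨x, by rw [cycleKey, if_pos h]⟩

theorem card_image_cycleKey (π : Perm α) : (univ.image (cycleKey π)).card = numCycles π := by
  rw [image_cycleKey, card_disjSum, card_compl, numCycles, cycleType_def, Multiset.card_map,
    add_comm]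
  rfl

/-- The functions invariant under a permutation are the functions on its set of cycles. -/
theorem card_invariant {β : Type*} [Fintype β] [DecidableEq β] (π : Perm α) :
    (univ.filter fun f : α → β => ∀ x, f (π x) = f x).card = Fintype.card β ^ numCycles π := by
  rw [← card_image_cycleKey, ← Fintype.card_coe (univ.image (cycleKey π)), ← Fintype.card_fun,
    ← card_univ]
  symm
  have key : ∀ x, cycleKey π x ∈ univ.image (cycleKey π) := fun x => mem_image_of_mem _ (mem_univ x)
  refine card_bij (fun F _ x => F ⟨cycleKey π x, key x⟩) ?_ ?_ ?_
  · intro F _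
    simp only [mem_filter, mem_univ, true_and]
    intro x
    congr 2
    rw [cycleKey_eq_iff]
    exact sameCycle_apply_left.2 (SameCycle.refl _ _)
  · intro F _ F' _ h
    ext1 ⟨c, hc⟩
    obtain ⟨x, -, rfl⟩ := mem_image.1 hc
    exact congrFun h x
  · intro f hf
    have hf' := (mem_filter.1 hf).2
    have hex : ∀ c : univ.image (cycleKey π), ∃ x, cycleKey π x = c := fun c => by
      obtain ⟨x, -, hx⟩ := mem_image.1 c.2
      exact ⟨x, hx⟩
    choose r hr using hex
    refine ⟨fun c => f (r c), mem_univ _, ?_⟩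
    ext1 x
    exact eq_of_sameCycle hf' ((cycleKey_eq_iff _ _ _).1 (hr _))

theorem sign_eq_neg_one_pow_card_add_numCycles (π : Perm α) :
    ((sign π : ℤ) : ℚ) = (-1) ^ (Fintype.card α + numCycles π) := by
  have hle : π.support.card ≤ Fintype.card α := card_le_univ _
  rw [sign_of_cycleType, sum_cycleType, numCycles]
  obtain ⟨d, hd⟩ := Nat.exists_eq_add_of_le hle
  rw [hd, Nat.add_sub_cancel_left]
  push_cast
  rw [show π.support.card + d + (d + π.cycleType.card) =
    π.support.card + π.cycleType.card + 2 * d by ring, pow_add _ _ (2 * d), pow_mul]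
  simp

/-- Signed count of the stabilizer of a function. -/
theorem sum_sign_stabilizer {β : Type*} [DecidableEq β] (f : α → β) :
    (∑ π : Perm α, if ∀ x, f (π x) = f x then ((sign π : ℤ) : ℚ) else 0) =
      open scoped Classical in if Function.Injective f then 1 else 0 := by
  split_ifs with hf
  · rw [Finset.sum_eq_single 1]
    · simp
    · intro π _ hπ
      rw [if_neg]
      intro h
      exact hπ (Equiv.ext fun x => hf (h x))
    · simp
  · simp only [Function.Injective, not_forall] at hf
    obtain ⟨i, j, hij, hne⟩ := hf
    have hswap : ∀ x, f (swap i j x) = f x := by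
      intro x
      rcases eq_or_ne x i with rfl | hi
      · rw [swap_apply_left, hij]
      · rcases eq_or_ne x j with rfl | hj
        · rw [swap_apply_right, hij]
        · rw [swap_apply_of_ne_of_ne hi hj]
    have h := Equiv.sum_comp (Equiv.mulLeft (swap i j))
      (fun π : Perm α => if ∀ x, f (π x) = f x then ((sign π : ℤ) : ℚ) else 0)
    simp only [Equiv.coe_mulLeft, mul_apply, hswap, Perm.sign_mul, sign_swap hne, neg_mul, one_mul,
      Units.val_neg, Int.cast_neg] at h
    have hneg : ∀ π : Perm α, (if ∀ x, f (π x) = f x then -((sign π : ℤ) : ℚ) else 0) =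
        -(if ∀ x, f (π x) = f x then ((sign π : ℤ) : ℚ) else 0) := fun π => by
      split_ifs <;> simp
    simp only [hneg, sum_neg_distrib] at h
    linarith

theorem sum_neg_pow_numCycles (c : ℕ) :
    ∑ π : Perm α, (-(c : ℚ)) ^ numCycles π =
      (-1) ^ Fintype.card α * (c.descFactorial (Fintype.card α) : ℚ) := by
  have h : ∀ π : Perm α, (-(c : ℚ)) ^ numCycles π = (-1) ^ Fintype.card α *
      ∑ f : α → Fin c, if ∀ x, f (π x) = f x then ((sign π : ℤ) : ℚ) else 0 := by
    intro π
    rw [← sum_filter, sum_const, card_invariant, sign_eq_neg_one_pow_card_add_numCycles,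
      Fintype.card_fin, nsmul_eq_mul, neg_pow, pow_add]
    push_cast
    have h1 : ((-1 : ℚ) ^ Fintype.card α) * (-1) ^ Fintype.card α = 1 := by
      rw [← mul_pow]; simp
    linear_combination -((-1 : ℚ) ^ numCycles π * (c : ℚ) ^ numCycles π) * h1
  simp only [h]
  rw [← mul_sum, sum_comm]
  simp only [sum_sign_stabilizer]
  classical
  rw [sum_boole, ← Fintype.card_subtype,
    Fintype.card_congr (Equiv.subtypeInjectiveEquivEmbedding α (Fin c)),
    Fintype.card_embedding_eq, Fintype.card_fin]

theorem exists_pow_apply_eq_of_cycCount_ne_zero {π : Perm α} {k : ℕ} (h : cycCount π k ≠ 0) :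
    ∃ x, (π ^ k) x = x := by
  unfold cycCount at h
  split_ifs at h with hk
  · subst hk
    have hlt : π.support.card < (univ : Finset α).card := by rw [card_univ]; omega
    obtain ⟨x, -, hx⟩ := exists_mem_notMem_of_card_lt_card hlt
    exact ⟨x, by simpa using notMem_support.1 hx⟩
  · have hm := Multiset.count_ne_zero.1 h
    rw [cycleType_def, Multiset.mem_map] at hm
    obtain ⟨c, hc, rfl⟩ := hm
    have hc : c ∈ π.cycleFactorsFinset := hc
    obtain ⟨x, hx⟩ := (mem_cycleFactorsFinset_iff.1 hc).1.nonempty_support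
    refine ⟨x, ?_⟩
    have := pow_mod_card_support_cycleOf_self_apply π (π.cycleOf x).support.card x
    rw [Nat.mod_self, ← cycle_is_cycleOf hx hc] at this
    simpa using this.symm

theorem exists_odd_cycCount_ne_zero {π : Perm α} {n : ℕ} (hn : Odd n) {x : α}
    (hx : (π ^ n) x = x) :
    ∃ k ∈ Icc 1 (Fintype.card α), Odd k ∧ cycCount π k ≠ 0 := by
  by_cases hfix : π x = x
  · have hs : x ∉ π.support := notMem_support.2 hfix
    have hlt : π.support.card < Fintype.card α := by
      rw [← card_univ]
      exact card_lt_card (ssubset_univ_iff.2 fun h => hs (h ▸ mem_univ x))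
    refine ⟨1, mem_Icc.2 ⟨le_rfl, by omega⟩, odd_one, ?_⟩
    rw [cycCount, if_pos rfl]
    omega
  · have hcyc := isCycle_cycleOf π hfix
    have hmem : π.cycleOf x ∈ π.cycleFactorsFinset :=
      cycleOf_mem_cycleFactorsFinset_iff.2 (mem_support.2 hfix)
    have hdvd : (π.cycleOf x).support.card ∣ n := by
      rw [← hcyc.orderOf]
      refine orderOf_dvd_of_pow_eq_one ((hcyc.pow_eq_one_iff).2 ⟨x, ?_, ?_⟩)
      · rwa [cycleOf_apply_self]
      · rw [cycleOf_pow_apply_self, hx]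
    have h2 := hcyc.two_le_card_support
    refine ⟨(π.cycleOf x).support.card, mem_Icc.2 ⟨by omega, card_le_univ _⟩,
      hn.of_dvd_nat hdvd, ?_⟩
    rw [cycCount, if_neg (by omega), Multiset.count_ne_zero, cycleType_def]
    exact Multiset.mem_map_of_mem (f := Finset.card ∘ support) hmem

theorem sum_cycCount_s6 (π : Perm α) :
    ∑ k ∈ Icc 1 (Fintype.card α), cycCount π k = numCycles π := by
  have hcount : ∑ k ∈ Icc 1 (Fintype.card α), π.cycleType.count k = π.cycleType.card :=
    Multiset.sum_count_eq_card fun k hk => mem_Icc.2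
      ⟨(one_lt_of_mem_cycleType hk).le, (le_card_support_of_mem_cycleType hk).trans
        (card_le_univ _)⟩
  rw [numCycles, ← hcount]
  rcases Nat.eq_zero_or_pos (Fintype.card α) with h0 | hpos
  · simp [h0]
  · have h1 : 1 ∈ Icc 1 (Fintype.card α) := mem_Icc.2 ⟨le_rfl, hpos⟩
    rw [← add_sum_erase _ _ h1, ← add_sum_erase _ (fun k => π.cycleType.count k) h1,
      Multiset.count_eq_zero_of_notMem (fun h => (one_lt_of_mem_cycleType h).ne rfl), zero_add,
      cycCount, if_pos rfl]
    congr 1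
    exact sum_congr rfl fun k hk => if_neg (ne_of_mem_erase hk)

theorem prod_pow_cycCount_eq_zero {π : Perm α} {n : ℕ} (hn : Odd n) {x : α} (hx : (π ^ n) x = x)
    (c : ℚ) :
    ∏ k ∈ Icc 1 (Fintype.card α), (if Odd k then 0 else c) ^ cycCount π k = 0 := by
  obtain ⟨k, hk, hko, hk0⟩ := exists_odd_cycCount_ne_zero hn hx
  exact prod_eq_zero hk (by rw [if_pos hko, zero_pow hk0])

theorem prod_pow_cycCount_eq_pow {π : Perm α} (h : ∀ n, Odd n → ∀ x, (π ^ n) x ≠ x) (c : ℚ) :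
    ∏ k ∈ Icc 1 (Fintype.card α), (if Odd k then 0 else c) ^ cycCount π k =
      c ^ numCycles π := by
  rw [← sum_cycCount_s6, ← prod_pow_eq_pow_sum]
  refine prod_congr rfl fun k _ => ?_
  split_ifs with hk
  · have : cycCount π k = 0 := by
      by_contra h0
      obtain ⟨x, hx⟩ := exists_pow_apply_eq_of_cycCount_ne_zero h0
      exact h k hk x hx
    simp [this]
  · rfl

end Orbits

section Wreath

variable {m : ℕ}

theorem prodShear_pow_apply_fst {ι β : Type*} (ρ : Perm ι) (τ : ι → Perm β) (n : ℕ) (p : ι × β) :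
    (((prodShear ρ τ : Perm (ι × β)) ^ n) p).1 = (ρ ^ n) p.1 := by
  induction n with
  | zero => rfl
  | succ n ih => rw [pow_succ', pow_succ', mul_apply, mul_apply, ← ih]; rfl

theorem prodShear_one_pow_apply {ι β : Type*} (τ : ι → Perm β) (n : ℕ) (i : ι) (x : β) :
    ((prodShear (1 : Perm ι) τ : Perm (ι × β)) ^ n) (i, x) = (i, (τ i ^ n) x) := by
  induction n with
  | zero => rfl
  | succ n ih => rw [pow_succ', pow_succ', mul_apply, mul_apply, ih]; rfl

/-- An element of the wreath product exchanging the two blocks has as many cycles as the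
permutation that its square induces on a block. -/
theorem numCycles_prodShear_swap (τ : Fin 2 → Perm (Fin m)) :
    numCycles (prodShear (swap 0 1) τ : Perm (Fin 2 × Fin m)) = numCycles (τ 1 * τ 0) := by
  apply Nat.pow_right_injective (le_refl 2)
  have h1 := card_invariant (β := Fin 2) (prodShear (swap 0 1) τ : Perm (Fin 2 × Fin m))
  have h2 := card_invariant (β := Fin 2) (τ 1 * τ 0)
  rw [Fintype.card_fin] at h1 h2
  show 2 ^ _ = 2 ^ _
  rw [← h1, ← h2]
  refine card_bij (fun f _ x => f (0, x)) ?_ ?_ ?_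
  · intro f hf
    simp only [mem_filter, mem_univ, true_and, prodShear_apply, mul_apply] at hf ⊢
    intro x
    have e0 := hf (0, x)
    have e1 := hf (1, τ 0 x)
    simp only [swap_apply_left, swap_apply_right] at e0 e1
    rw [e1, e0]
  · intro f hf f' hf' h
    simp only [mem_filter, mem_univ, true_and, prodShear_apply] at hf hf'
    ext1 ⟨i, x⟩
    fin_cases i
    · exact congrFun h x
    · have e := hf (1, x)
      have e' := hf' (1, x)
      simp only [swap_apply_right] at e e'
      exact e.symm.trans ((congrFun h (τ 1 x)).trans e')
  · intro f hf
    simp only [mem_filter, mem_univ, true_and, mul_apply] at hf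
    refine ⟨fun p => if p.1 = 0 then f p.2 else f (τ 1 p.2), ?_, ?_⟩
    · simp only [mem_filter, mem_univ, true_and, prodShear_apply]
      rintro ⟨i, x⟩
      fin_cases i
      · simpa using hf x
      · simp
    · ext1 x
      simp

theorem prodShear_injective [NeZero m] {k : ℕ} :
    Function.Injective fun p : Perm (Fin k) × (Fin k → Perm (Fin m)) =>
      (prodShear p.1 p.2 : Perm (Fin k × Fin m)) := by
  rintro ⟨ρ, τ⟩ ⟨ρ', τ'⟩ h
  have h' : ∀ i x, (ρ i, τ i x) = (ρ' i, τ' i x) := fun i x => Equiv.congr_fun h (i, x)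
  refine Prod.ext (Equiv.ext fun i => congrArg Prod.fst (h' i 0)) ?_
  exact funext fun i => Equiv.ext fun x => congrArg Prod.snd (h' i x)

theorem mem_wreath_top_iff {k : ℕ} {σ : Perm (Fin k × Fin m)} :
    σ ∈ wreath k m ⊤ ↔
      ∃ p : Perm (Fin k) × (Fin k → Perm (Fin m)), (prodShear p.1 p.2 : Perm _) = σ := by
  constructor
  · rintro ⟨ρ, τ, h⟩
    exact ⟨(ρ, fun i => τ i), Equiv.ext fun ⟨i, x⟩ => (h i x).symm⟩
  · rintro ⟨p, rfl⟩
    exact ⟨p.1, fun i => ⟨p.2 i, trivial⟩, fun _ _ => rfl⟩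

open scoped Classical in
theorem filter_mem_wreath_top {k : ℕ} :
    (univ.filter fun σ : Perm (Fin k × Fin m) => σ ∈ wreath k m ⊤) =
      univ.image fun p : Perm (Fin k) × (Fin k → Perm (Fin m)) =>
        (prodShear p.1 p.2 : Perm (Fin k × Fin m)) := by
  ext σ
  simp [mem_wreath_top_iff]

theorem card_wreath_top [NeZero m] (k : ℕ) :
    Nat.card (wreath k m ⊤) = k.factorial * m.factorial ^ k := by
  classical
  rw [Nat.card_eq_fintype_card, Fintype.card_subtype, filter_mem_wreath_top,
    card_image_of_injective _ prodShear_injective, card_univ]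
  simp [Fintype.card_perm]

end Wreath

/-- for `m` odd positive,
`Z(S_2 ≀ S_m; 0, −2g, 0, −2g, …) = −(1/2)·C(2g, m)`.  (This is the signature of the
iterated symmetric product `SP²(SP^m(M_{g,k}))` for `k ≥ 1`.) -/
theorem cycleIndex_wreath_two_symm_odd (m g : ℕ) (hm : Odd m) (hm0 : 0 < m) :
    cycleIndex (wreath 2 m (⊤ : Subgroup (Equiv.Perm (Fin m))))
        (fun k => if Odd k then 0 else -(2 * g : ℚ)) =
      -(1 / 2 : ℚ) * ((2 * g).choose m : ℚ) := by
  have : NeZero m := ⟨hm0.ne'⟩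
  have hone (τ : Fin 2 → Perm (Fin m)) :
      ∏ k ∈ Icc 1 (Fintype.card (Fin 2 × Fin m)), (if Odd k then 0 else -(2 * g : ℚ)) ^
        cycCount (prodShear 1 τ : Perm (Fin 2 × Fin m)) k = 0 := by
    obtain ⟨n, hn, x, hx⟩ := exists_odd_pow_apply_eq (by rwa [Fintype.card_fin]) (τ 0)
    exact prod_pow_cycCount_eq_zero hn (x := (0, x)) (by rw [prodShear_one_pow_apply, hx]) _
  have hswap (τ : Fin 2 → Perm (Fin m)) :
      ∏ k ∈ Icc 1 (Fintype.card (Fin 2 × Fin m)), (if Odd k then 0 else -(2 * g : ℚ)) ^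
        cycCount (prodShear (swap 0 1) τ : Perm (Fin 2 × Fin m)) k =
      (-((2 * g : ℕ) : ℚ)) ^ numCycles (τ 1 * τ 0) := by
    rw [prod_pow_cycCount_eq_pow, numCycles_prodShear_swap]
    · push_cast
      rfl
    · rintro n ⟨r, rfl⟩ ⟨i, x⟩ h
      have h1 := congrArg Prod.fst h
      rw [prodShear_pow_apply_fst, pow_succ, pow_mul, sq, swap_mul_self, one_pow, one_mul] at h1
      fin_cases i <;> simp at h1
  have hperm : (univ : Finset (Perm (Fin 2))) = {1, swap 0 1} := by decide
  have hne : (1 : Perm (Fin 2)) ≠ swap 0 1 := by decide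
  have hsum : ∑ τ : Fin 2 → Perm (Fin m), (-((2 * g : ℕ) : ℚ)) ^ numCycles (τ 1 * τ 0) =
      m.factorial * ((-1) ^ m * ((2 * g).descFactorial m : ℚ)) := by
    rw [Fintype.sum_equiv (finTwoArrowEquiv (Perm (Fin m)))
      (fun τ => (-((2 * g : ℕ) : ℚ)) ^ numCycles (τ 1 * τ 0))
      (fun p => (-((2 * g : ℕ) : ℚ)) ^ numCycles (p.2 * p.1)) (fun _ => rfl),
      Fintype.sum_prod_type]
    have h (a : Perm (Fin m)) := Equiv.sum_comp (Equiv.mulRight a)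
      (fun b : Perm (Fin m) => (-((2 * g : ℕ) : ℚ)) ^ numCycles b)
    simp only [Equiv.coe_mulRight] at h
    simp only [h, sum_neg_pow_numCycles, sum_const, card_univ, Fintype.card_perm,
      Fintype.card_fin, nsmul_eq_mul]
  rw [cycleIndex, filter_mem_wreath_top, sum_image prodShear_injective.injOn,
    Fintype.sum_prod_type, hperm, sum_pair hne, card_wreath_top]
  simp only [hone, hswap, sum_const_zero, zero_add, hsum, hm.neg_one_pow,
    Nat.descFactorial_eq_factorial_mul_choose]
  have hf : (m.factorial : ℚ) ≠ 0 := Nat.cast_ne_zero.2 m.factorial_ne_zero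
  push_cast [Nat.factorial_two]
  field_simp
end
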